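/- The number of reduced Latin triangles of side length 7 is exactly 27820. -/

import Mathlib

/-- The index set of a Latin triangle of side length `n`:
pairs `(i,j)` of positive integers with `i + j ≤ n + 1`. -/
def TriIdx (n : ℕ) : Type :=
  {p : ℕ × ℕ // 1 ≤ p.1 ∧ 1 ≤ p.2 ∧ p.1 + p.2 ≤ n + 1}

/-- `M` is a Latin triangle of side length `n`: it assigns to each pair `(i,j)`
of positive integers with `i + j ≤ n + 1` a value in `{1,…,n}`, taking distinct
values on each row (same `i`), each left diagonal (same `j`), and each right
diagonal (same `i + j`). -/
def IsLatinTriangle (n : ℕ) (M : TriIdx n → ℕ) : Prop :=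
  (∀ p : TriIdx n, 1 ≤ M p ∧ M p ≤ n) ∧
  (∀ p q : TriIdx n, p.val.1 = q.val.1 → p ≠ q → M p ≠ M q) ∧
  (∀ p q : TriIdx n, p.val.2 = q.val.2 → p ≠ q → M p ≠ M q) ∧
  (∀ p q : TriIdx n, p.val.1 + p.val.2 = q.val.1 + q.val.2 → p ≠ q → M p ≠ M q)

/-- A Latin triangle is reduced if its bottom row is the identity:
`M (1, j) = j` for all `j`. -/
def IsReducedLatinTriangle (n : ℕ) (M : TriIdx n → ℕ) : Prop :=
  ∀ p : TriIdx n, p.val.1 = 1 → M p = p.val.2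

/-! Cells `(i,j)` are coded as `8*i+j`; sets of cells are coded as bit masks. -/

/-- All 28 cells, in the order used by the search. -/
def cells : List ℕ :=
  [11, 13, 12, 17, 26, 42, 34, 28, 22, 57, 35, 27, 21, 18, 49, 10, 20, 19, 50, 14, 29, 41, 25, 43, 15, 9, 36, 33]

/-- Two cells do not lie on a common line. -/
def compat (a b : ℕ) : Bool :=
  !(Nat.beq (a / 8) (b / 8)) && (!(Nat.beq (a % 8) (b % 8)) &&
    !(Nat.beq (a / 8 + a % 8) (b / 8 + b % 8)))

/-- A list of cells meets all three sides of the triangle. -/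
def sides (l : List ℕ) : Bool :=
  l.any (fun c => Nat.beq (c / 8) 1) && (l.any (fun c => Nat.beq (c % 8) 1) &&
    l.any (fun c => Nat.beq (c / 8 + c % 8) 8))

/-- All extensions of `l` by cells of the first list which are pairwise compatible
and meet all sides. -/
def gen : List ℕ → List ℕ → List (List ℕ)
  | [], l => if sides l then [l] else []
  | c :: cs, l => gen cs l ++ (if l.all (compat c) then gen cs (c :: l) else [])

def mask (l : List ℕ) : ℕ := l.foldr (fun c m => 2 ^ c ||| m) 0

/-- The masks of all possible colour classes. -/
def classes : List ℕ := (gen cells []).map mask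

/-- The maximal size of a colour class with the given bottom cell, minus its size. -/
def defi (q : ℕ) : ℕ :=
  (if Nat.beq (q &&& (2 ^ 9 + 2 ^ 10 + 2 ^ 14 + 2 ^ 15)) 0 then 5 else 4) -
    (cells.filter (fun c => q.testBit c)).length

def mkRows : List ℕ → List ℕ → List (ℕ × List (ℕ × ℕ))
  | [], _ => []
  | c :: cs, L => (2 ^ c, (L.filter (fun q => q.testBit c)).map (fun q => (q, defi q))) ::
      mkRows cs (L.filter (fun q => !q.testBit c))

/-- Evaluate the first argument before passing it on. -/
def force (n : ℕ) (f : ℕ → ℕ) : ℕ :=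
  Nat.rec (motive := fun _ => ℕ) (nat_lit 0) (fun k _ => f k) (Nat.add n (nat_lit 1))

def bucketSum (ih : ℕ → ℕ → ℕ) (S D : ℕ) (b : List (ℕ × ℕ)) : ℕ :=
  List.rec (motive := fun _ => ℕ) (nat_lit 0) (fun it _ t =>
    Nat.add (Prod.rec (motive := fun _ => ℕ) (fun q e =>
      Bool.rec (motive := fun _ => ℕ) (nat_lit 0)
        (Bool.rec (motive := fun _ => ℕ) (nat_lit 0)
          (force (Nat.lor S q) (fun S' => force (Nat.sub D e) (fun D' => ih S' D')))
          (Nat.ble e D))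
        (Nat.beq (Nat.land S q) (nat_lit 0))) it) t) b

def cov (rows : List (ℕ × List (ℕ × ℕ))) : ℕ → ℕ → ℕ :=
  List.rec (motive := fun _ => ℕ → ℕ → ℕ) (fun _ _ => nat_lit 1)
    (fun r _ ih S D => Prod.rec (motive := fun _ => ℕ)
      (fun c b => Bool.rec (motive := fun _ => ℕ) (ih S D) (bucketSum ih S D b)
        (Nat.beq (Nat.land S c) (nat_lit 0))) r) rows

/-- The search table, evaluated. -/
def table : List (ℕ × List (ℕ × ℕ)) := [
  (nat_lit 2048, [(nat_lit 2267742734336, nat_lit 2),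
    (nat_lit 9126807552, nat_lit 2),
    (nat_lit 2199560128512, nat_lit 2),
    (nat_lit 1125908496779264, nat_lit 2),
    (nat_lit 1128098930100224, nat_lit 2),
    (nat_lit 9127856128, nat_lit 1),
    (nat_lit 1125908497827840, nat_lit 1),
    (nat_lit 563018672900096, nat_lit 2),
    (nat_lit 562950490294272, nat_lit 2),
    (nat_lit 562950491342848, nat_lit 1),
    (nat_lit 2267744831488, nat_lit 1),
    (nat_lit 1125908498876416, nat_lit 1),
    (nat_lit 1128098932197376, nat_lit 1),
    (nat_lit 144115188075857920, nat_lit 3),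
    (nat_lit 144115188076906496, nat_lit 2),
    (nat_lit 144115188077955072, nat_lit 2),
    (nat_lit 8594130944, nat_lit 2),
    (nat_lit 2199027451904, nat_lit 2),
    (nat_lit 562949957617664, nat_lit 2),
    (nat_lit 1125908765214720, nat_lit 1),
    (nat_lit 1128099198535680, nat_lit 1),
    (nat_lit 144115188344293376, nat_lit 2),
    (nat_lit 8862566400, nat_lit 1),
    (nat_lit 2199295887360, nat_lit 1),
    (nat_lit 562967670163456, nat_lit 1),
    (nat_lit 144115205255727104, nat_lit 2),
    (nat_lit 144115205257824256, nat_lit 1),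
    (nat_lit 562967137486848, nat_lit 1),
    (nat_lit 144115205524162560, nat_lit 1),
    (nat_lit 4407173318656, nat_lit 1),
    (nat_lit 4407174367232, nat_lit 0),
    (nat_lit 144119586122369024, nat_lit 2),
    (nat_lit 144119586123417600, nat_lit 1),
    (nat_lit 4406640642048, nat_lit 1),
    (nat_lit 2267809843200, nat_lit 1),
    (nat_lit 563018740008960, nat_lit 1),
    (nat_lit 2267811940352, nat_lit 0),
    (nat_lit 144115188142966784, nat_lit 2),
    (nat_lit 144115188144015360, nat_lit 1),
    (nat_lit 144115188145063936, nat_lit 1),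
    (nat_lit 2199094560768, nat_lit 1),
    (nat_lit 562950024726528, nat_lit 1),
    (nat_lit 68719609856, nat_lit 2),
    (nat_lit 537004032, nat_lit 2),
    (nat_lit 1125899906975744, nat_lit 2),
    (nat_lit 1125900175411200, nat_lit 1),
    (nat_lit 17716873216, nat_lit 1),
    (nat_lit 4466766120960, nat_lit 1),
    (nat_lit 4398583515136, nat_lit 1),
    (nat_lit 68786718720, nat_lit 1)]),
  (nat_lit 8192, [(nat_lit 8804682964992, nat_lit 2),
    (nat_lit 68753039360, nat_lit 2),
    (nat_lit 8796126584832, nat_lit 2),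
    (nat_lit 1125908496785408, nat_lit 2),
    (nat_lit 1125899940405248, nat_lit 2),
    (nat_lit 68753563648, nat_lit 1),
    (nat_lit 1125899940929536, nat_lit 1),
    (nat_lit 563018672906240, nat_lit 2),
    (nat_lit 571746046451712, nat_lit 2),
    (nat_lit 563018673430528, nat_lit 1),
    (nat_lit 8804683227136, nat_lit 1),
    (nat_lit 563018673168384, nat_lit 1),
    (nat_lit 571746046713856, nat_lit 1),
    (nat_lit 1125934300143616, nat_lit 1),
    (nat_lit 144115188075864064, nat_lit 3),
    (nat_lit 144115188076388352, nat_lit 2),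
    (nat_lit 144115188076126208, nat_lit 2),
    (nat_lit 144115222435602432, nat_lit 2),
    (nat_lit 144115222435864576, nat_lit 1),
    (nat_lit 8594137088, nat_lit 2),
    (nat_lit 37756928, nat_lit 2),
    (nat_lit 562949957623808, nat_lit 2),
    (nat_lit 34397495296, nat_lit 1),
    (nat_lit 8804951400448, nat_lit 1),
    (nat_lit 1125908765220864, nat_lit 1),
    (nat_lit 8804951662592, nat_lit 0),
    (nat_lit 144115188344299520, nat_lit 2),
    (nat_lit 144115188344823808, nat_lit 1),
    (nat_lit 144115188344561664, nat_lit 1),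
    (nat_lit 8862572544, nat_lit 1),
    (nat_lit 4466799550464, nat_lit 1),
    (nat_lit 4466800074752, nat_lit 0),
    (nat_lit 144119586122375168, nat_lit 2),
    (nat_lit 144119586122899456, nat_lit 1),
    (nat_lit 4406640648192, nat_lit 1),
    (nat_lit 4398084268032, nat_lit 1),
    (nat_lit 563018740015104, nat_lit 1),
    (nat_lit 571746113560576, nat_lit 1),
    (nat_lit 144115188142972928, nat_lit 2),
    (nat_lit 144115222502711296, nat_lit 1),
    (nat_lit 562950024732672, nat_lit 1),
    (nat_lit 68719616000, nat_lit 2),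
    (nat_lit 8796093161472, nat_lit 2),
    (nat_lit 1125899906981888, nat_lit 2),
    (nat_lit 1125934266720256, nat_lit 1),
    (nat_lit 8796361596928, nat_lit 1),
    (nat_lit 1125900175417344, nat_lit 1),
    (nat_lit 4466766127104, nat_lit 1),
    (nat_lit 68786724864, nat_lit 1),
    (nat_lit 8796160270336, nat_lit 1)]),
  (nat_lit 4096, [(nat_lit 8796126580736, nat_lit 2),
    (nat_lit 2199560130560, nat_lit 2),
    (nat_lit 1125899940401152, nat_lit 2),
    (nat_lit 1128098930102272, nat_lit 2),
    (nat_lit 571746046447616, nat_lit 2),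
    (nat_lit 562950490296320, nat_lit 2),
    (nat_lit 2199560392704, nat_lit 1),
    (nat_lit 571746046709760, nat_lit 1),
    (nat_lit 562950490558464, nat_lit 1),
    (nat_lit 8796128677888, nat_lit 1),
    (nat_lit 1125899942498304, nat_lit 1),
    (nat_lit 1128098932199424, nat_lit 1),
    (nat_lit 2233919868928, nat_lit 1),
    (nat_lit 1125934300139520, nat_lit 1),
    (nat_lit 1128133289840640, nat_lit 1),
    (nat_lit 2233920131072, nat_lit 0),
    (nat_lit 144115188075859968, nat_lit 3),
    (nat_lit 144115188076122112, nat_lit 2),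
    (nat_lit 144115188077957120, nat_lit 2),
    (nat_lit 144115188210077696, nat_lit 2),
    (nat_lit 144115188210339840, nat_lit 1),
    (nat_lit 144115188212174848, nat_lit 1),
    (nat_lit 144115222435598336, nat_lit 2),
    (nat_lit 144115222435860480, nat_lit 1),
    (nat_lit 37752832, nat_lit 2),
    (nat_lit 2199027453952, nat_lit 2),
    (nat_lit 562949957619712, nat_lit 2),
    (nat_lit 562950091837440, nat_lit 1),
    (nat_lit 34397491200, nat_lit 1),
    (nat_lit 2233387192320, nat_lit 1),
    (nat_lit 8813306449920, nat_lit 1),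
    (nat_lit 571763226316800, nat_lit 1),
    (nat_lit 562967670165504, nat_lit 1),
    (nat_lit 8813308547072, nat_lit 0),
    (nat_lit 144115205255729152, nat_lit 2),
    (nat_lit 144115205257826304, nat_lit 1),
    (nat_lit 17217622016, nat_lit 1),
    (nat_lit 562967137488896, nat_lit 1),
    (nat_lit 144119586122371072, nat_lit 2),
    (nat_lit 144119586256588800, nat_lit 1),
    (nat_lit 4398084263936, nat_lit 1),
    (nat_lit 8796093157376, nat_lit 2),
    (nat_lit 537006080, nat_lit 2),
    (nat_lit 1125899906977792, nat_lit 2),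
    (nat_lit 1125900041195520, nat_lit 1),
    (nat_lit 34896744448, nat_lit 1),
    (nat_lit 1125934266716160, nat_lit 1),
    (nat_lit 8813273026560, nat_lit 1),
    (nat_lit 17716875264, nat_lit 1),
    (nat_lit 4398583517184, nat_lit 1)]),
  (nat_lit 131072, [(nat_lit 163840, nat_lit 2),
    (nat_lit 68719624192, nat_lit 1),
    (nat_lit 8796093169664, nat_lit 1),
    (nat_lit 537018368, nat_lit 1),
    (nat_lit 1125899906990080, nat_lit 1),
    (nat_lit 134381568, nat_lit 1),
    (nat_lit 68853841920, nat_lit 0),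
    (nat_lit 1125900041207808, nat_lit 0),
    (nat_lit 34359902208, nat_lit 1),
    (nat_lit 268599296, nat_lit 1),
    (nat_lit 17180033024, nat_lit 1),
    (nat_lit 8813273038848, nat_lit 0),
    (nat_lit 17716887552, nat_lit 0),
    (nat_lit 17448468480, nat_lit 0),
    (nat_lit 4398046674944, nat_lit 1),
    (nat_lit 4398180892672, nat_lit 0),
    (nat_lit 67272704, nat_lit 1),
    (nat_lit 68786733056, nat_lit 0),
    (nat_lit 8796160278528, nat_lit 0),
    (nat_lit 34427011072, nat_lit 0)]),
  (nat_lit 67108864, [(nat_lit 68786586112, nat_lit 1),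
    (nat_lit 8796160131584, nat_lit 1),
    (nat_lit 2199090397184, nat_lit 1),
    (nat_lit 2267809857536, nat_lit 0),
    (nat_lit 8796161180160, nat_lit 0),
    (nat_lit 562950020562944, nat_lit 1),
    (nat_lit 562950021611520, nat_lit 0),
    (nat_lit 68788683264, nat_lit 0),
    (nat_lit 8796162228736, nat_lit 0),
    (nat_lit 2199092494336, nat_lit 0),
    (nat_lit 2233450135552, nat_lit 0),
    (nat_lit 144115188142981120, nat_lit 1),
    (nat_lit 144115188144029696, nat_lit 0),
    (nat_lit 71303680, nat_lit 1),
    (nat_lit 34431042048, nat_lit 0)]),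
  (nat_lit 4398046511104, [(nat_lit 4466765988352, nat_lit 1),
    (nat_lit 4406636478464, nat_lit 1),
    (nat_lit 4398080098304, nat_lit 1),
    (nat_lit 4398583382528, nat_lit 1),
    (nat_lit 4466766512640, nat_lit 0),
    (nat_lit 4398080622592, nat_lit 0),
    (nat_lit 4398583906816, nat_lit 0),
    (nat_lit 4406637527040, nat_lit 0),
    (nat_lit 4398081146880, nat_lit 0),
    (nat_lit 4398584431104, nat_lit 0),
    (nat_lit 4466900206080, nat_lit 0),
    (nat_lit 4406770696192, nat_lit 0),
    (nat_lit 4398050705920, nat_lit 1),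
    (nat_lit 4398184923648, nat_lit 0)]),
  (nat_lit 17179869184, [(nat_lit 8813272891904, nat_lit 1),
    (nat_lit 17213456384, nat_lit 1),
    (nat_lit 17716740608, nat_lit 1),
    (nat_lit 8813306462208, nat_lit 0),
    (nat_lit 17213980672, nat_lit 0),
    (nat_lit 17717264896, nat_lit 0),
    (nat_lit 562967133323264, nat_lit 1),
    (nat_lit 562967133847552, nat_lit 0),
    (nat_lit 8813274989056, nat_lit 0),
    (nat_lit 17215553536, nat_lit 0),
    (nat_lit 144115205255741440, nat_lit 1),
    (nat_lit 144115205256265728, nat_lit 0),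
    (nat_lit 17184064000, nat_lit 1),
    (nat_lit 8813541327360, nat_lit 0),
    (nat_lit 17452499456, nat_lit 0)]),
  (nat_lit 268435456, [(nat_lit 8858402816, nat_lit 1),
    (nat_lit 8796361458176, nat_lit 1),
    (nat_lit 2199291723776, nat_lit 1),
    (nat_lit 1125900175278592, nat_lit 1),
    (nat_lit 2199292248064, nat_lit 0),
    (nat_lit 1125900175802880, nat_lit 0),
    (nat_lit 8804951393280, nat_lit 0),
    (nat_lit 8858664960, nat_lit 0),
    (nat_lit 8796361720320, nat_lit 0),
    (nat_lit 2199291985920, nat_lit 0),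
    (nat_lit 144115188344292352, nat_lit 1),
    (nat_lit 144115188344816640, nat_lit 0),
    (nat_lit 272630272, nat_lit 1),
    (nat_lit 8862565376, nat_lit 0),
    (nat_lit 2199295886336, nat_lit 0)]),
  (nat_lit 4194304, [(nat_lit 4194816, nat_lit 2),
    (nat_lit 8594129920, nat_lit 1),
    (nat_lit 37749760, nat_lit 1),
    (nat_lit 2199027450880, nat_lit 1),
    (nat_lit 562949957616640, nat_lit 1),
    (nat_lit 138412544, nat_lit 1),
    (nat_lit 8728347648, nat_lit 0),
    (nat_lit 562950091834368, nat_lit 0),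
    (nat_lit 34363933184, nat_lit 1),
    (nat_lit 34397488128, nat_lit 0),
    (nat_lit 2233387189248, nat_lit 0)]),
  (nat_lit 144115188075855872, [(nat_lit 144115188075872256, nat_lit 2),
    (nat_lit 144115188076396544, nat_lit 1),
    (nat_lit 144115188076920832, nat_lit 1),
    (nat_lit 144115188075856896, nat_lit 2),
    (nat_lit 144115188076381184, nat_lit 1),
    (nat_lit 144115188076905472, nat_lit 1),
    (nat_lit 144115188076134400, nat_lit 1),
    (nat_lit 144115188077954048, nat_lit 1),
    (nat_lit 144115188210089984, nat_lit 1),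
    (nat_lit 144115188210074624, nat_lit 1),
    (nat_lit 144115188210352128, nat_lit 0),
    (nat_lit 144115188212171776, nat_lit 0),
    (nat_lit 144115222435595264, nat_lit 1),
    (nat_lit 144115222436643840, nat_lit 0)]),
  (nat_lit 34359738368, [(nat_lit 34393325568, nat_lit 1),
    (nat_lit 2233383026688, nat_lit 1),
    (nat_lit 34896609792, nat_lit 1),
    (nat_lit 1125934266581504, nat_lit 1),
    (nat_lit 34394374144, nat_lit 0),
    (nat_lit 34897658368, nat_lit 0),
    (nat_lit 1125934267630080, nat_lit 0),
    (nat_lit 2233919865856, nat_lit 0),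
    (nat_lit 2233383288832, nat_lit 0),
    (nat_lit 34896871936, nat_lit 0)]),
  (nat_lit 134217728, [(nat_lit 68853694976, nat_lit 1),
    (nat_lit 8724185088, nat_lit 1),
    (nat_lit 1125900041060864, nat_lit 1),
    (nat_lit 1125908631011328, nat_lit 0),
    (nat_lit 562950087671808, nat_lit 1),
    (nat_lit 563018807116800, nat_lit 0),
    (nat_lit 68853957120, nat_lit 0),
    (nat_lit 8724447232, nat_lit 0),
    (nat_lit 562950087933952, nat_lit 0),
    (nat_lit 68855792128, nat_lit 0),
    (nat_lit 8726282240, nat_lit 0),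
    (nat_lit 1125900043158016, nat_lit 0)]),
  (nat_lit 2097152, [(nat_lit 68721574400, nat_lit 1),
    (nat_lit 8592064512, nat_lit 1),
    (nat_lit 8796095119872, nat_lit 1),
    (nat_lit 35684352, nat_lit 1),
    (nat_lit 2199025385472, nat_lit 1),
    (nat_lit 1125899908940288, nat_lit 1),
    (nat_lit 8804685054976, nat_lit 0),
    (nat_lit 68755129344, nat_lit 0),
    (nat_lit 8796128674816, nat_lit 0),
    (nat_lit 2267744830464, nat_lit 0)]),
  (nat_lit 262144, [(nat_lit 68719739392, nat_lit 1),
    (nat_lit 8590229504, nat_lit 1),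
    (nat_lit 8796093284864, nat_lit 1),
    (nat_lit 2199023550464, nat_lit 1),
    (nat_lit 537133568, nat_lit 1),
    (nat_lit 8804683235328, nat_lit 0),
    (nat_lit 2267743010816, nat_lit 0),
    (nat_lit 9127084032, nat_lit 0),
    (nat_lit 2199560404992, nat_lit 0),
    (nat_lit 562949953716224, nat_lit 1)]),
  (nat_lit 562949953421312, [(nat_lit 562949953454080, nat_lit 2),
    (nat_lit 562949953978368, nat_lit 1),
    (nat_lit 562949954502656, nat_lit 1),
    (nat_lit 563018672899072, nat_lit 1),
    (nat_lit 571746046444544, nat_lit 1),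
    (nat_lit 562950490293248, nat_lit 1),
    (nat_lit 563018673423360, nat_lit 0),
    (nat_lit 562950490817536, nat_lit 0),
    (nat_lit 571746047493120, nat_lit 0),
    (nat_lit 562950491341824, nat_lit 0)]),
  (nat_lit 1024, [(nat_lit 8804682957824, nat_lit 1),
    (nat_lit 68753032192, nat_lit 1),
    (nat_lit 8796126577664, nat_lit 1),
    (nat_lit 2267742733312, nat_lit 1),
    (nat_lit 9126806528, nat_lit 1),
    (nat_lit 2199560127488, nat_lit 1),
    (nat_lit 68753556480, nat_lit 0),
    (nat_lit 2267743257600, nat_lit 0),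
    (nat_lit 2199560651776, nat_lit 0),
    (nat_lit 8804684006400, nat_lit 0),
    (nat_lit 8796127626240, nat_lit 0),
    (nat_lit 9127855104, nat_lit 0)]),
  (nat_lit 1048576, [(nat_lit 8591015936, nat_lit 1),
    (nat_lit 8796094071296, nat_lit 1),
    (nat_lit 34635776, nat_lit 1),
    (nat_lit 537920000, nat_lit 1),
    (nat_lit 8804684021760, nat_lit 0),
    (nat_lit 8796127641600, nat_lit 0),
    (nat_lit 9127870464, nat_lit 0),
    (nat_lit 1125899907891712, nat_lit 1),
    (nat_lit 1125908497842176, nat_lit 0),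
    (nat_lit 1125899941462016, nat_lit 0)]),
  (nat_lit 524288, [(nat_lit 68720001536, nat_lit 1),
    (nat_lit 34111488, nat_lit 1),
    (nat_lit 2199023812608, nat_lit 1),
    (nat_lit 537395712, nat_lit 1),
    (nat_lit 68753571840, nat_lit 0),
    (nat_lit 2267743272960, nat_lit 0),
    (nat_lit 2199560667136, nat_lit 0),
    (nat_lit 1125899907367424, nat_lit 1),
    (nat_lit 1125899940937728, nat_lit 0),
    (nat_lit 1128098930638848, nat_lit 0)]),
  (nat_lit 1125899906842624, [(nat_lit 1125899906843136, nat_lit 2),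
    (nat_lit 1125908496793600, nat_lit 1),
    (nat_lit 1125899940413440, nat_lit 1),
    (nat_lit 1128098930114560, nat_lit 1)]),
  (nat_lit 16384, [(nat_lit 8804682973184, nat_lit 1),
    (nat_lit 68753047552, nat_lit 1),
    (nat_lit 8796126593024, nat_lit 1),
    (nat_lit 2267742748672, nat_lit 1),
    (nat_lit 9126821888, nat_lit 1),
    (nat_lit 2199560142848, nat_lit 1)]),
  (nat_lit 536870912, [(nat_lit 536871424, nat_lit 2)]),
  (nat_lit 2199023255552, [(nat_lit 2199023288320, nat_lit 2)]),
  (nat_lit 33554432, [(nat_lit 33587200, nat_lit 2)]),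
  (nat_lit 8796093022208, [(nat_lit 8796093022720, nat_lit 2)]),
  (nat_lit 32768, [(nat_lit 8589967360, nat_lit 2)]),
  (nat_lit 512, [(nat_lit 68719477248, nat_lit 2)]),
  (nat_lit 68719476736, []),
  (nat_lit 8589934592, [])]

/-! ### The search table -/

theorem table_eq : mkRows cells classes = table := by decide +kernel

theorem cov_table : cov table (nat_lit 0) (nat_lit 3) = nat_lit 27820 := by decide +kernel

theorem classes_size : (classes.all fun q => Nat.ble (cells.filter (fun c => q.testBit c)).length
    (if Nat.beq (q &&& (2 ^ 9 + 2 ^ 10 + 2 ^ 14 + 2 ^ 15)) 0 then 5 else 4)) = true := by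
  decide +kernel

theorem nodup_classes : classes.Nodup := by decide +kernel

/-! ### Generic facts -/

theorem mem_cells {c : ℕ} : c ∈ cells ↔ 1 ≤ c / 8 ∧ 1 ≤ c % 8 ∧ c / 8 + c % 8 ≤ 7 + 1 := by
  constructor
  · have h : ∀ c ∈ cells, 1 ≤ c / 8 ∧ 1 ≤ c % 8 ∧ c / 8 + c % 8 ≤ 7 + 1 := by decide
    exact h c
  · have h : ∀ c < 64, 1 ≤ c / 8 ∧ 1 ≤ c % 8 ∧ c / 8 + c % 8 ≤ 7 + 1 → c ∈ cells := by decide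
    intro hc
    exact h c (by omega) hc

theorem nodup_cells : cells.Nodup := by decide

theorem nbeq {a b : ℕ} : Nat.beq a b = true ↔ a = b :=
  ⟨Nat.eq_of_beq_eq_true, fun h => h ▸ Nat.beq_refl a⟩

theorem compat_iff {a b : ℕ} : compat a b = true ↔
    a / 8 ≠ b / 8 ∧ a % 8 ≠ b % 8 ∧ a / 8 + a % 8 ≠ b / 8 + b % 8 := by
  simp only [compat, Bool.and_eq_true, Bool.not_eq_true', ← Bool.not_eq_true, nbeq, ne_eq]

theorem testBit_mask (l : List ℕ) (c : ℕ) : (mask l).testBit c = true ↔ c ∈ l := by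
  induction l with
  | nil => simp [mask]
  | cons a l ih =>
    have : mask (a :: l) = 2 ^ a ||| mask l := rfl
    rw [this, Nat.testBit_or, Bool.or_eq_true, ih, Nat.testBit_two_pow]
    simp [eq_comm]

theorem gen_sound (cs : List ℕ) : ∀ l : List ℕ, l.Pairwise (fun a b => compat a b = true) →
    ∀ m ∈ gen cs l, m.Pairwise (fun a b => compat a b = true) ∧ sides m = true ∧
      ∀ c ∈ m, c ∈ cs ∨ c ∈ l := by
  induction cs with
  | nil =>
    intro l hl m hm
    simp only [gen] at hm
    split_ifs at hm with h
    · simp only [List.mem_singleton] at hm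
      subst hm
      exact ⟨hl, h, fun c hc => Or.inr hc⟩
    · simp at hm
  | cons a cs ih =>
    intro l hl m hm
    simp only [gen, List.mem_append] at hm
    rcases hm with hm | hm
    · obtain ⟨h1, h2, h3⟩ := ih l hl m hm
      refine ⟨h1, h2, fun c hc => ?_⟩
      rcases h3 c hc with h | h
      · exact Or.inl (List.mem_cons_of_mem _ h)
      · exact Or.inr h
    · split_ifs at hm with h
      · rw [List.all_eq_true] at h
        obtain ⟨h1, h2, h3⟩ := ih (a :: l) (List.pairwise_cons.2 ⟨h, hl⟩) m hm
        refine ⟨h1, h2, fun c hc => ?_⟩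
        rcases h3 c hc with h | h
        · exact Or.inl (List.mem_cons_of_mem _ h)
        · rcases List.mem_cons.1 h with h | h
          · exact Or.inl (h ▸ List.mem_cons_self)
          · exact Or.inr h
      · simp at hm

theorem gen_complete (p : ℕ → Bool) (hp : ∀ a b, p a = true → p b = true → a ≠ b →
      a ∈ cells → b ∈ cells → compat a b = true) (cs : List ℕ) : ∀ l : List ℕ,
    cs.Nodup → (∀ a ∈ l, a ∉ cs) → (∀ a ∈ l, p a = true) → (∀ a ∈ l, a ∈ cells) →
    (∀ a ∈ cs, a ∈ cells) →
    sides ((cs.filter p).reverse ++ l) = true → (cs.filter p).reverse ++ l ∈ gen cs l := by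
  induction cs with
  | nil =>
    intro l _ _ _ _ _ hs
    simp only [List.filter_nil, List.reverse_nil, List.nil_append] at hs ⊢
    simp [gen, hs]
  | cons a cs ih =>
    intro l hn hd hl hlc hc hs
    rw [List.nodup_cons] at hn
    simp only [gen, List.mem_append]
    by_cases ha : p a = true
    · right
      rw [List.filter_cons_of_pos ha, List.reverse_cons, List.append_assoc] at hs ⊢
      have hall : l.all (compat a) = true := by
        rw [List.all_eq_true]
        intro b hb
        refine hp a b ha (hl b hb) ?_ (hc a List.mem_cons_self) (hlc b hb)
        rintro rfl
        exact hd a hb List.mem_cons_self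
      rw [if_pos hall]
      refine ih (a :: l) hn.2 ?_ ?_ ?_ (fun b hb => hc b (List.mem_cons_of_mem _ hb)) hs
      · intro b hb
        rcases List.mem_cons.1 hb with rfl | hb
        · exact hn.1
        · exact fun h => hd b hb (List.mem_cons_of_mem _ h)
      · intro b hb
        rcases List.mem_cons.1 hb with rfl | hb
        · exact ha
        · exact hl b hb
      · intro b hb
        rcases List.mem_cons.1 hb with rfl | hb
        · exact hc b List.mem_cons_self
        · exact hlc b hb
    · left
      rw [List.filter_cons_of_neg ha] at hs ⊢
      exact ih l hn.2 (fun b hb h => hd b hb (List.mem_cons_of_mem _ h)) hl hlc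
        (fun b hb => hc b (List.mem_cons_of_mem _ hb)) hs

theorem classes_cell {q c : ℕ} (hq : q ∈ classes) (hc : q.testBit c = true) : c ∈ cells := by
  obtain ⟨l, hl, rfl⟩ := List.mem_map.1 hq
  rw [testBit_mask] at hc
  rcases (gen_sound cells [] List.Pairwise.nil l hl).2.2 c hc with h | h
  · exact h
  · simp at h

theorem compat_symm {a b : ℕ} (h : compat a b = true) : compat b a = true := by
  rw [compat_iff] at *
  exact ⟨h.1.symm, h.2.1.symm, h.2.2.symm⟩

theorem classes_compat {q a b : ℕ} (hq : q ∈ classes) (ha : q.testBit a = true)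
    (hb : q.testBit b = true) (hab : a ≠ b) : compat a b = true := by
  obtain ⟨l, hl, rfl⟩ := List.mem_map.1 hq
  rw [testBit_mask] at ha hb
  have := (gen_sound cells [] List.Pairwise.nil l hl).1
  have hsy : Std.Symm (fun a b => compat a b = true) := ⟨fun _ _ h => compat_symm h⟩
  exact this.forall ha hb hab

theorem classes_bottom {q : ℕ} (hq : q ∈ classes) :
    ∃ v, 1 ≤ v ∧ v ≤ 7 ∧ q.testBit (8 + v) = true := by
  have hq' := hq
  obtain ⟨l, hl, rfl⟩ := List.mem_map.1 hq
  have := (gen_sound cells [] List.Pairwise.nil l hl).2.1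
  simp only [sides, Bool.and_eq_true, List.any_eq_true, nbeq] at this
  obtain ⟨⟨c, hc, h1⟩, -⟩ := this
  have hb := (testBit_mask l c).2 hc
  have := mem_cells.1 (classes_cell hq' hb)
  refine ⟨c - 8, by omega, by omega, ?_⟩
  rwa [show 8 + (c - 8) = c by omega]

/-! ### Latin triangles -/

def latSet : Set (TriIdx 7 → ℕ) := {M | IsLatinTriangle 7 M ∧ IsReducedLatinTriangle 7 M}

def val (M : TriIdx 7 → ℕ) (c : ℕ) : ℕ :=
  if h : 1 ≤ c / 8 ∧ 1 ≤ c % 8 ∧ c / 8 + c % 8 ≤ 7 + 1 then M ⟨(c / 8, c % 8), h⟩ else 0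

def cls (M : TriIdx 7 → ℕ) (v : ℕ) : ℕ := mask (cells.filter (fun c => val M c == v)).reverse

theorem testBit_cls (M : TriIdx 7 → ℕ) (v c : ℕ) :
    (cls M v).testBit c = true ↔ c ∈ cells ∧ val M c = v := by
  simp [cls, testBit_mask]


theorem val_range {M : TriIdx 7 → ℕ} (hM : M ∈ latSet) {c : ℕ} (hc : c ∈ cells) : 1 ≤ val M c ∧ val M c ≤ 7 := by
  rw [val, dif_pos (mem_cells.1 hc)]
  exact hM.1.1 _

theorem val_compat {M : TriIdx 7 → ℕ} (hM : M ∈ latSet) {a b : ℕ} (ha : a ∈ cells) (hb : b ∈ cells) (hab : a ≠ b)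
    (h : val M a = val M b) : compat a b = true := by
  rw [val, val, dif_pos (mem_cells.1 ha), dif_pos (mem_cells.1 hb)] at h
  rw [compat_iff]
  have hne : (⟨(a / 8, a % 8), mem_cells.1 ha⟩ : TriIdx 7) ≠ ⟨(b / 8, b % 8), mem_cells.1 hb⟩ := by
    intro h
    have := congrArg Subtype.val h
    simp only [Prod.mk.injEq] at this
    omega
  exact ⟨fun e => hM.1.2.1 _ _ e hne h, fun e => hM.1.2.2.1 _ _ e hne h,
    fun e => hM.1.2.2.2 _ _ e hne h⟩

theorem val_bottom {M : TriIdx 7 → ℕ} (hM : M ∈ latSet) {j : ℕ} (h1 : 1 ≤ j) (h7 : j ≤ 7) : val M (8 + j) = j := by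
  have hc : 8 + j ∈ cells := mem_cells.2 (by omega)
  rw [val, dif_pos (mem_cells.1 hc)]
  refine (hM.2 ⟨((8 + j) / 8, (8 + j) % 8), mem_cells.1 hc⟩ ?_).trans ?_
  · show (8 + j) / 8 = 1
    omega
  · show (8 + j) % 8 = j
    omega

theorem exists_on_line {M : TriIdx 7 → ℕ} (hM : M ∈ latSet) (f : ℕ → ℕ) (hf : ∀ i ∈ Finset.Icc 1 7, f i ∈ cells)
    (hinj : ∀ i ∈ Finset.Icc 1 7, ∀ j ∈ Finset.Icc 1 7, i ≠ j →
      f i ≠ f j ∧ compat (f i) (f j) = false) {v : ℕ} (h1 : 1 ≤ v) (h7 : v ≤ 7) :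
    ∃ i ∈ Finset.Icc 1 7, val M (f i) = v := by
  have := Finset.surjOn_of_injOn_of_card_le (s := Finset.Icc 1 7) (t := Finset.Icc 1 7)
    (fun i => val M (f i)) (fun i hi => by
      have := val_range hM (hf i hi)
      simpa using this) (fun i hi j hj h => by
      by_contra hne
      have h3 := hinj i hi j hj hne
      have := val_compat hM (hf i hi) (hf j hj) h3.1 h
      rw [h3.2] at this
      exact absurd this (by simp)) le_rfl
  obtain ⟨i, hi, h⟩ := this (show v ∈ (Finset.Icc 1 7 : Finset ℕ) by simp [h1, h7])
  exact ⟨i, hi, h⟩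

theorem cls_mem {M : TriIdx 7 → ℕ} (hM : M ∈ latSet) {v : ℕ} (h1 : 1 ≤ v) (h7 : v ≤ 7) : cls M v ∈ classes := by
  refine List.mem_map_of_mem ?_
  have := gen_complete (fun c => val M c == v) (fun a b ha hb hab hac hbc => by
    simp only [beq_iff_eq] at ha hb
    exact val_compat hM hac hbc hab (ha.trans hb.symm)) cells [] nodup_cells
    (by simp) (by simp) (by simp) (fun a ha => ha)
  rw [List.append_nil] at this
  apply this
  simp only [sides, Bool.and_eq_true, List.any_eq_true, nbeq, List.mem_reverse,
    List.mem_filter, beq_iff_eq]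
  refine ⟨⟨8 + v, ⟨mem_cells.2 (by omega), val_bottom hM h1 h7⟩, by omega⟩, ?_, ?_⟩
  · obtain ⟨i, hi, h⟩ := exists_on_line hM (fun i => 8 * i + 1) (by decide) (by decide) h1 h7
    simp only [Finset.mem_Icc] at hi
    exact ⟨8 * i + 1, ⟨mem_cells.2 (by omega), h⟩, by omega⟩
  · obtain ⟨i, hi, h⟩ := exists_on_line hM (fun i => 7 * i + 8) (by decide) (by decide) h1 h7
    simp only [Finset.mem_Icc] at hi
    exact ⟨7 * i + 8, ⟨mem_cells.2 (by omega), h⟩, by omega⟩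

theorem cls_inj {M : TriIdx 7 → ℕ} (hM : M ∈ latSet) : Set.InjOn (cls M) (Finset.Icc 1 7 : Finset ℕ) := by
  intro v hv w hw h
  simp only [Finset.coe_Icc, Set.mem_Icc] at hv hw
  have h1 := (testBit_cls M v (8 + v)).2 ⟨mem_cells.2 (by omega), val_bottom hM hv.1 hv.2⟩
  rw [h, testBit_cls, val_bottom hM hv.1 hv.2] at h1
  exact h1.2

theorem defi_sum {M : TriIdx 7 → ℕ} (hM : M ∈ latSet) : ∑ v ∈ Finset.Icc 1 7, defi (cls M v) = 3 := by
  have hs : ∀ v, (cells.filter (fun c => (cls M v).testBit c)).length =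
      (cells.toFinset.filter (fun c => val M c = v)).card := by
    intro v
    rw [← List.toFinset_card_of_nodup (nodup_cells.filter _)]
    congr 1
    ext c
    simp [testBit_cls]
  have hsum : ∑ v ∈ Finset.Icc 1 7, (cells.toFinset.filter (fun c => val M c = v)).card = 28 := by
    rw [← Finset.card_eq_sum_card_fiberwise (f := fun c => val M c)]
    · decide
    · intro c hc
      have := val_range hM (c := c) (by simpa using hc)
      simpa using this
  have hle := List.all_eq_true.1 classes_size
  have key : ∀ v, 1 ≤ v → v ≤ 7 → defi (cls M v) +
      (cells.toFinset.filter (fun c => val M c = v)).card =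
      if v = 3 ∨ v = 4 ∨ v = 5 then 5 else 4 := by
    intro v h1 h7
    have h := hle _ (cls_mem hM h1 h7)
    rw [Nat.ble_eq] at h
    have hb : (Nat.beq (cls M v &&& (2 ^ 9 + 2 ^ 10 + 2 ^ 14 + 2 ^ 15)) 0 = true) ↔
        (v = 3 ∨ v = 4 ∨ v = 5) := by
      have hbit : ∀ j, 1 ≤ j → j ≤ 7 → ((cls M v).testBit (8 + j) = true ↔ j = v) := by
        intro j hj1 hj7
        rw [testBit_cls, val_bottom hM hj1 hj7]
        exact ⟨fun h => h.2, fun h => ⟨mem_cells.2 (by omega), h⟩⟩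
      have hm : ∀ k, Nat.testBit (2 ^ 9 + 2 ^ 10 + 2 ^ 14 + 2 ^ 15) k = true ↔
          k = 9 ∨ k = 10 ∨ k = 14 ∨ k = 15 := by
        intro k
        have : (2 ^ 9 + 2 ^ 10 + 2 ^ 14 + 2 ^ 15 : ℕ) = mask [9, 10, 14, 15] := by decide
        rw [this, testBit_mask]
        simp
      rw [nbeq]
      constructor
      · intro h0
        by_contra hv
        have h3 : (cls M v &&& (2 ^ 9 + 2 ^ 10 + 2 ^ 14 + 2 ^ 15)).testBit (8 + v) = true := by
          rw [Nat.testBit_and, Bool.and_eq_true]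
          exact ⟨(hbit v h1 h7).2 rfl, (hm _).2 (by omega)⟩
        rw [h0] at h3
        simp at h3
      · intro hv
        apply Nat.eq_of_testBit_eq
        intro k
        rw [Nat.zero_testBit, Bool.eq_false_iff]
        intro h3
        rw [Nat.testBit_and, Bool.and_eq_true, hm] at h3
        have := (hbit (k - 8) (by omega) (by omega)).1 (by
          rw [show 8 + (k - 8) = k by omega]; exact h3.1)
        omega
    rw [defi]
    rw [hs] at h ⊢
    simp only [hb] at h ⊢
    omega
  have e1 := key 1 (by norm_num) (by norm_num)
  have e2 := key 2 (by norm_num) (by norm_num)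
  have e3 := key 3 (by norm_num) (by norm_num)
  have e4 := key 4 (by norm_num) (by norm_num)
  have e5 := key 5 (by norm_num) (by norm_num)
  have e6 := key 6 (by norm_num) (by norm_num)
  have e7 := key 7 (by norm_num) (by norm_num)
  have hI : Finset.Icc 1 7 = ({1, 2, 3, 4, 5, 6, 7} : Finset ℕ) := by decide
  rw [hI] at hsum ⊢
  simp at hsum e1 e2 e3 e4 e5 e6 e7 ⊢
  omega

/-! ### Correctness of the search -/

theorem cov_nil (S D : ℕ) : cov [] S D = 1 := rfl

theorem cov_cons (c : ℕ) (b : List (ℕ × ℕ)) (t : List (ℕ × List (ℕ × ℕ))) (S D : ℕ) :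
    cov ((c, b) :: t) S D = if S &&& c = 0 then bucketSum (cov t) S D b else cov t S D := by
  have h : cov ((c, b) :: t) S D = Bool.rec (motive := fun _ => ℕ) (cov t S D)
    (bucketSum (cov t) S D b) (Nat.beq (S &&& c) 0) := rfl
  rw [h]
  by_cases h0 : S &&& c = 0
  · rw [if_pos h0, nbeq.2 h0]
  · rw [if_neg h0, Bool.eq_false_iff.2 (fun h => h0 (nbeq.1 h))]

theorem bucketSum_nil (ih : ℕ → ℕ → ℕ) (S D : ℕ) : bucketSum ih S D [] = 0 := rfl

theorem bucketSum_cons (ih : ℕ → ℕ → ℕ) (S D q e : ℕ) (b : List (ℕ × ℕ)) :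
    bucketSum ih S D ((q, e) :: b) =
      (if S &&& q = 0 ∧ e ≤ D then ih (S ||| q) (D - e) else 0) + bucketSum ih S D b := by
  have h : bucketSum ih S D ((q, e) :: b) = Bool.rec (motive := fun _ => ℕ) 0
    (Bool.rec (motive := fun _ => ℕ) 0 (ih (S ||| q) (D - e)) (Nat.ble e D))
      (Nat.beq (S &&& q) 0) + bucketSum ih S D b := rfl
  rw [h]
  congr 1
  by_cases h0 : S &&& q = 0
  · rw [nbeq.2 h0]
    by_cases h1 : e ≤ D
    · rw [if_pos ⟨h0, h1⟩, Nat.ble_eq_true_of_le h1]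
    · rw [if_neg (fun h => h1 h.2), Bool.eq_false_iff.2 (fun h => h1 (Nat.le_of_ble_eq_true h))]
  · rw [if_neg (fun h => h0 h.1), Bool.eq_false_iff.2 (fun h => h0 (nbeq.1 h))]

theorem land_eq_zero {a b : ℕ} :
    a &&& b = 0 ↔ ∀ c, a.testBit c = true → b.testBit c = true → False := by
  constructor
  · intro h c ha hb
    have : (a &&& b).testBit c = true := by rw [Nat.testBit_and, ha, hb]; rfl
    rw [h] at this
    simp at this
  · intro h
    apply Nat.eq_of_testBit_eq
    intro c
    rw [Nat.zero_testBit, Bool.eq_false_iff, Nat.testBit_and]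
    intro h2
    rw [Bool.and_eq_true] at h2
    exact h c h2.1 h2.2

theorem land_two_pow_eq_zero {S c : ℕ} : S &&& 2 ^ c = 0 ↔ ¬ S.testBit c = true := by
  rw [land_eq_zero]
  constructor
  · intro h hc
    exact h c hc (by simp)
  · intro h d hd hd2
    rw [Nat.testBit_two_pow] at hd2
    simp only [decide_eq_true_eq] at hd2
    subst hd2
    exact h hd

/-- The Latin triangles having all the members of `H` as colour classes. -/
def solSet (H : Finset ℕ) : Set (TriIdx 7 → ℕ) :=
  {M | M ∈ latSet ∧ ∀ q ∈ H, ∃ v, 1 ≤ v ∧ v ≤ 7 ∧ cls M v = q}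

structure SearchInv (H : Finset ℕ) (S D : ℕ) : Prop where
  mem : ∀ q ∈ H, q ∈ classes
  disj : ∀ q ∈ H, ∀ r ∈ H, ∀ c, q.testBit c = true → r.testBit c = true → q = r
  bits : ∀ c, S.testBit c = true ↔ ∃ q ∈ H, q.testBit c = true
  bud : D + ∑ q ∈ H, defi q = 3

theorem cls_eq_of_testBit {M : TriIdx 7 → ℕ} {v c : ℕ} (h : (cls M v).testBit c = true) :
    cls M (val M c) = cls M v := by
  rw [((testBit_cls M v c).1 h).2]

theorem solSet_bud {H : Finset ℕ} {M : TriIdx 7 → ℕ} (hM : M ∈ solSet H) :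
    ∑ q ∈ H, defi q ≤ 3 := by
  rw [← defi_sum hM.1, ← Finset.sum_image (f := defi) (cls_inj hM.1)]
  apply Finset.sum_le_sum_of_subset
  intro q hq
  obtain ⟨v, h1, h7, h⟩ := hM.2 q hq
  exact Finset.mem_image.2 ⟨v, Finset.mem_Icc.2 ⟨h1, h7⟩, h⟩

theorem solSet_insert {H : Finset ℕ} {c q : ℕ} (hcc : c ∈ cells) (hq : q.testBit c = true) :
    {M | M ∈ solSet H ∧ cls M (val M c) = q} = solSet (insert q H) := by
  ext M
  constructor
  · rintro ⟨⟨h1, h2⟩, h3⟩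
    refine ⟨h1, fun r hr => ?_⟩
    rcases Finset.mem_insert.1 hr with rfl | hr
    · have := val_range h1 hcc
      exact ⟨_, this.1, this.2, h3⟩
    · exact h2 r hr
  · rintro ⟨h1, h2⟩
    refine ⟨⟨h1, fun r hr => h2 r (Finset.mem_insert_of_mem hr)⟩, ?_⟩
    obtain ⟨v, hv1, hv7, h⟩ := h2 q (Finset.mem_insert_self _ _)
    rw [← h] at hq
    rw [cls_eq_of_testBit hq, h]

theorem bucketSum_correct {H : Finset ℕ} {S D c : ℕ} (hI : SearchInv H S D) (hcc : c ∈ cells)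
    (hS : ¬ S.testBit c = true) (f : ℕ → ℕ → ℕ)
    (hf : ∀ q ∈ classes, q.testBit c = true → SearchInv (insert q H) (S ||| q) (D - defi q) →
      (solSet (insert q H)).encard = f (S ||| q) (D - defi q)) (b : List ℕ) (hb : b.Nodup)
    (hbc : ∀ q ∈ b, q ∈ classes ∧ q.testBit c = true) :
    {M | M ∈ solSet H ∧ cls M (val M c) ∈ b}.encard =
      bucketSum f S D (b.map (fun q => (q, defi q))) := by
  induction b with
  | nil => simp [bucketSum_nil]
  | cons q b ih =>
    rw [List.nodup_cons] at hb
    have ih' := ih hb.2 (fun r hr => hbc r (List.mem_cons_of_mem _ hr))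
    obtain ⟨hq, hqc⟩ := hbc q List.mem_cons_self
    have hqH : q ∉ H := fun h => hS ((hI.bits c).2 ⟨q, h, hqc⟩)
    rw [List.map_cons, bucketSum_cons, Nat.cast_add, ← ih']
    have hun : {M | M ∈ solSet H ∧ cls M (val M c) ∈ q :: b} =
        {M | M ∈ solSet H ∧ cls M (val M c) = q} ∪ {M | M ∈ solSet H ∧ cls M (val M c) ∈ b} := by
      ext M
      simp only [List.mem_cons, Set.mem_ofPred_eq, Set.mem_union]
      tauto
    rw [hun, Set.encard_union_eq]
    · congr 1
      rw [solSet_insert hcc hqc]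
      split_ifs with h
      · apply hf q hq hqc
        refine ⟨?_, ?_, ?_, ?_⟩
        · intro r hr
          rcases Finset.mem_insert.1 hr with rfl | hr
          · exact hq
          · exact hI.mem r hr
        · have h0 := land_eq_zero.1 h.1
          intro r hr s hs d hrd hsd
          rcases Finset.mem_insert.1 hr with e1 | hr'
          · rcases Finset.mem_insert.1 hs with e2 | hs'
            · rw [e1, e2]
            · exact (h0 d ((hI.bits d).2 ⟨s, hs', hsd⟩) (e1 ▸ hrd)).elim
          · rcases Finset.mem_insert.1 hs with e2 | hs'
            · exact (h0 d ((hI.bits d).2 ⟨r, hr', hrd⟩) (e2 ▸ hsd)).elim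
            · exact hI.disj r hr' s hs' d hrd hsd
        · intro d
          rw [Nat.testBit_or, Bool.or_eq_true, hI.bits]
          simp only [Finset.exists_mem_insert]
          exact or_comm
        · rw [Finset.sum_insert hqH]
          have := hI.bud
          have := h.2
          omega
      · rw [Nat.cast_zero, Set.encard_eq_zero, Set.eq_empty_iff_forall_notMem]
        intro M hM
        apply h
        constructor
        · rw [land_eq_zero]
          intro d hSd hqd
          obtain ⟨r, hr, hrd⟩ := (hI.bits d).1 hSd
          obtain ⟨v, -, -, rfl⟩ := hM.2 r (Finset.mem_insert_of_mem hr)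
          obtain ⟨w, -, -, rfl⟩ := hM.2 q (Finset.mem_insert_self _ _)
          have h1 := cls_eq_of_testBit hrd
          rw [cls_eq_of_testBit hqd] at h1
          exact hqH (h1 ▸ hr)
        · have h1 := solSet_bud hM
          rw [Finset.sum_insert hqH] at h1
          have := hI.bud
          omega
    · rw [Set.disjoint_left]
      rintro M ⟨_, h1⟩ ⟨_, h2⟩
      exact hb.1 (h1 ▸ h2)

theorem leaf_correct {H : Finset ℕ} {S D : ℕ} (hI : SearchInv H S D)
    (hS : ∀ c ∈ cells, S.testBit c = true) : (solSet H).encard = 1 := by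
  have hcov : ∀ c : ℕ, ∃ q, c ∈ cells → q ∈ H ∧ q.testBit c = true := by
    intro c
    by_cases hc : c ∈ cells
    · obtain ⟨q, hq⟩ := (hI.bits c).1 (hS c hc)
      exact ⟨q, fun _ => hq⟩
    · exact ⟨0, fun h => absurd h hc⟩
  choose g hg using hcov
  have hsym : ∀ q : ℕ, ∃ v, q ∈ H → 1 ≤ v ∧ v ≤ 7 ∧ q.testBit (8 + v) = true := by
    intro q
    by_cases hq : q ∈ H
    · obtain ⟨v, hv⟩ := classes_bottom (hI.mem q hq)
      exact ⟨v, fun _ => hv⟩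
    · exact ⟨0, fun h => absurd h hq⟩
  choose s hs using hsym
  have hsinj : ∀ q ∈ H, ∀ r ∈ H, s q = s r → q = r := by
    intro q hq r hr h
    refine hI.disj q hq r hr (8 + s q) (hs q hq).2.2 ?_
    rw [h]
    exact (hs r hr).2.2
  have hgq : ∀ c ∈ cells, ∀ q ∈ H, q.testBit c = true → g c = q := by
    intro c hc q hq h
    exact hI.disj _ (hg c hc).1 q hq c (hg c hc).2 h
  let N : TriIdx 7 → ℕ := fun p => s (g (8 * p.val.1 + p.val.2))
  have hcode : ∀ p : TriIdx 7, 8 * p.val.1 + p.val.2 ∈ cells := by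
    intro p
    obtain ⟨h1, h2, h3⟩ := p.2
    exact mem_cells.2 (by omega)
  have hdiv : ∀ p : TriIdx 7, (8 * p.val.1 + p.val.2) / 8 = p.val.1 := by
    intro p
    obtain ⟨h1, h2, h3⟩ := p.2
    omega
  have hmod : ∀ p : TriIdx 7, (8 * p.val.1 + p.val.2) % 8 = p.val.2 := by
    intro p
    obtain ⟨h1, h2, h3⟩ := p.2
    omega
  have hNval : ∀ c ∈ cells, val N c = s (g c) := by
    intro c hc
    rw [val, dif_pos (mem_cells.1 hc)]
    show s (g (8 * (c / 8) + c % 8)) = _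
    rw [Nat.div_add_mod]
  have hNlat : ∀ p q : TriIdx 7, p ≠ q → N p = N q →
      compat (8 * p.val.1 + p.val.2) (8 * q.val.1 + q.val.2) = true := by
    intro p q hpq h
    have e := hsinj _ (hg _ (hcode p)).1 _ (hg _ (hcode q)).1 h
    refine classes_compat (hI.mem _ (hg _ (hcode p)).1) (hg _ (hcode p)).2 ?_ ?_
    · rw [e]
      exact (hg _ (hcode q)).2
    · intro hh
      apply hpq
      obtain ⟨h1, h2, h3⟩ := p.2
      obtain ⟨h4, h5, h6⟩ := q.2
      apply Subtype.ext
      apply Prod.ext <;> omega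
  have hN : N ∈ latSet := by
    refine ⟨⟨?_, ?_, ?_, ?_⟩, ?_⟩
    · intro p
      have := hs _ (hg _ (hcode p)).1
      exact ⟨this.1, this.2.1⟩
    · intro p q h1 hpq h
      have := compat_iff.1 (hNlat p q hpq h)
      rw [hdiv p, hdiv q, hmod p, hmod q] at this
      exact this.1 h1
    · intro p q h1 hpq h
      have := compat_iff.1 (hNlat p q hpq h)
      rw [hdiv p, hdiv q, hmod p, hmod q] at this
      exact this.2.1 h1
    · intro p q h1 hpq h
      have := compat_iff.1 (hNlat p q hpq h)
      rw [hdiv p, hdiv q, hmod p, hmod q] at this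
      exact this.2.2 h1
    · intro p h1
      have hp := hg _ (hcode p)
      have h2 := hs _ hp.1
      show s (g (8 * p.val.1 + p.val.2)) = p.val.2
      by_contra hne
      obtain ⟨h3, h4, h5⟩ := p.2
      have := compat_iff.1 (classes_compat (hI.mem _ hp.1) hp.2 h2.2.2 (by omega))
      omega
  have hNcls : ∀ q ∈ H, cls N (s q) = q := by
    intro q hq
    apply Nat.eq_of_testBit_eq
    intro c
    rw [Bool.eq_iff_iff, testBit_cls]
    constructor
    · rintro ⟨hc, h⟩
      rw [hNval c hc] at h
      have := hsinj _ (hg c hc).1 q hq h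
      rw [← this]
      exact (hg c hc).2
    · intro h
      have hc := classes_cell (hI.mem q hq) h
      refine ⟨hc, ?_⟩
      rw [hNval c hc, hgq c hc q hq h]
  rw [Set.encard_eq_one]
  refine ⟨N, ?_⟩
  rw [Set.eq_singleton_iff_unique_mem]
  refine ⟨⟨hN, fun q hq => ⟨s q, (hs q hq).1, (hs q hq).2.1, hNcls q hq⟩⟩, ?_⟩
  intro M hM
  funext p
  obtain ⟨hq, hqc⟩ := hg _ (hcode p)
  obtain ⟨v, h1, h7, hv⟩ := hM.2 _ hq
  have hb := (hs _ hq).2.2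
  have hb' := hs _ hq
  rw [← hv, testBit_cls] at hb
  have e1 : val M (8 + s (cls M v)) = s (cls M v) := val_bottom hM.1 (by rw [hv]; exact hb'.1)
    (by rw [hv]; exact hb'.2.1)
  rw [← hv, testBit_cls] at hqc
  have e2 : val M (8 * p.val.1 + p.val.2) = M p := by
    obtain ⟨h3, h4, h5⟩ := p.2
    rw [val, dif_pos (mem_cells.1 (hcode p))]
    congr 1
    apply Subtype.ext
    apply Prod.ext
    · show (8 * p.val.1 + p.val.2) / 8 = p.val.1
      omega
    · show (8 * p.val.1 + p.val.2) % 8 = p.val.2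
      omega
  show M p = s (g (8 * p.val.1 + p.val.2))
  rw [← hv, ← e2, hqc.2]
  exact hb.2.symm.trans e1

theorem cov_correct (cs : List ℕ) : ∀ (L : List ℕ) (H : Finset ℕ) (S D : ℕ),
    SearchInv H S D → (∀ c ∈ cells, c ∈ cs ∨ S.testBit c = true) → (∀ c ∈ cs, c ∈ cells) →
    L.Nodup → (∀ q ∈ L, q ∈ classes) →
    (∀ q ∈ classes, (∀ c, q.testBit c = true → ¬ S.testBit c = true) → q ∈ L) →
    (solSet H).encard = cov (mkRows cs L) S D := by
  induction cs with
  | nil =>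
    intro L H S D hI hc _ _ _ _
    rw [leaf_correct hI (fun c h => (hc c h).resolve_left (by simp))]
    rfl
  | cons c cs ih =>
    intro L H S D hI hc hcs hn hL hall
    have hcs' : ∀ d ∈ cs, d ∈ cells := fun d hd => hcs d (List.mem_cons_of_mem _ hd)
    rw [mkRows, cov_cons]
    have hL' : ∀ q ∈ L.filter (fun q => !q.testBit c), q ∈ classes :=
      fun q hq => hL q (List.mem_filter.1 hq).1
    split_ifs with h
    · rw [land_two_pow_eq_zero] at h
      rw [← bucketSum_correct hI (hcs c List.mem_cons_self) h _ ?_ _ (hn.filter _)]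
      · congr 1
        ext M
        simp only [Set.mem_ofPred_eq, List.mem_filter, iff_self_and]
        intro hM
        have hcc := hcs c List.mem_cons_self
        have hv := val_range hM.1 hcc
        refine ⟨hall _ (cls_mem hM.1 hv.1 hv.2) ?_, (testBit_cls _ _ _).2 ⟨hcc, rfl⟩⟩
        intro d hd hSd
        obtain ⟨r, hr, hrd⟩ := (hI.bits d).1 hSd
        obtain ⟨w, -, -, rfl⟩ := hM.2 r hr
        have e1 := cls_eq_of_testBit hrd
        rw [cls_eq_of_testBit hd] at e1
        exact h ((hI.bits c).2 ⟨_, hr, e1 ▸ (testBit_cls _ _ _).2 ⟨hcc, rfl⟩⟩)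
      · intro q hq
        have := List.mem_filter.1 hq
        exact ⟨hL q this.1, this.2⟩
      · intro q hq hqc hI'
        refine ih _ _ _ _ hI' ?_ hcs' (hn.filter _) hL' ?_
        · intro d hd
          rw [Nat.testBit_or, Bool.or_eq_true]
          rcases hc d hd with h | h
          · rcases List.mem_cons.1 h with rfl | h
            · exact Or.inr (Or.inr hqc)
            · exact Or.inl h
          · exact Or.inr (Or.inl h)
        · intro r hr hd
          rw [List.mem_filter]
          refine ⟨hall r hr (fun d h1 h2 => hd d h1 (by
            rw [Nat.testBit_or, h2]; rfl)), ?_⟩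
          rw [Bool.not_eq_true', Bool.eq_false_iff]
          intro h1
          exact hd c h1 (by rw [Nat.testBit_or, hqc, Bool.or_true])
    · rw [land_two_pow_eq_zero, not_not] at h
      refine ih _ _ _ _ hI ?_ hcs' (hn.filter _) hL' ?_
      · intro d hd
        rcases hc d hd with h1 | h1
        · rcases List.mem_cons.1 h1 with rfl | h1
          · exact Or.inr h
          · exact Or.inl h1
        · exact Or.inr h1
      · intro r hr hd
        rw [List.mem_filter]
        refine ⟨hall r hr hd, ?_⟩
        rw [Bool.not_eq_true', Bool.eq_false_iff]
        intro h1
        exact hd c h1 h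

theorem latSet_encard : latSet.encard = 27820 := by
  have h := cov_correct cells classes ∅ 0 3 ⟨by simp, by simp, by simp, by simp⟩
    (fun c hc => Or.inl hc) (fun c hc => hc) nodup_classes (fun q hq => hq) (fun q hq _ => hq)
  have e : solSet ∅ = latSet := by
    ext M
    simp [solSet]
  have h2 : cov table 0 3 = 27820 := cov_table
  rw [e, table_eq, h2] at h
  exact h

/-- The number of reduced Latin triangles of side length 7 is exactly 27820. -/
theorem reduced_latin_triangles_side_7 :
    Set.ncard {M : TriIdx 7 → ℕ |
      IsLatinTriangle 7 M ∧ IsReducedLatinTriangle 7 M} = 27820 := by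
  show latSet.ncard = 27820
  rw [Set.ncard, latSet_encard]
  rfl
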